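/- Let β, u, t, s ∈ ℝ, q, r ∈ ℚ, and let a : ℕ → ℝ be a sequence such that for every integer c ≥ 1 the sequence ({a(n)/c}, {(βa(n)+u)/c})_{n≥1} is equidistributed in [0,1)², i.e., for every (k, l) ∈ ℤ²∖{(0,0)}, (1/N)·Σ_{n=1}^N e((k·a(n) + l·(βa(n)+u))/c) → 0 as N → ∞. Then lim_{N→∞} (1/N)·Σ_{n=1}^N e(q·a(n) + r·β·a(n) − {a(n)}·t + {βa(n)+u}·s) exists and equals e(−ru)·J_q·J_r, where J_q = 0 if q ∉ ℤ; J_q = 1 if q ∈ ℤ and q = t; J_q = 0 if q ∈ ℤ and q − t ∈ ℤ∖{0}; J_q = (e(q−t) − 1)/(2πi(q−t)) if q ∈ ℤ and q − t ∉ ℤ; and where J_r = 0 if r ∉ ℤ; J_r = 1 if r ∈ ℤ and r = −s; J_r = 0 if r ∈ ℤ and r + s ∈ ℤ∖{0}; J_r = (e(r+s) − 1)/(2πi(r+s)) if r ∈ ℤ and r + s ∉ ℤ. In particular the limit is 0 if and only if q ∉ ℤ, or q − t ∈ ℤ∖{0}, or r ∉ ℤ, or r + s ∈ ℤ∖{0}.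 -/

import Mathlib

open Filter Finset
open scoped Classical

noncomputable section

/-- `e(x) = exp(2πix)`. -/
def e (x : ℝ) : ℂ := Complex.exp (2 * (Real.pi : ℂ) * Complex.I * (x : ℂ))

/-- The factor `J_q`: `0` if `q ∉ ℤ`; `1` if `q ∈ ℤ` and `q = t`; `0` if `q ∈ ℤ` and
`q − t ∈ ℤ∖{0}`; `(e(q−t) − 1)/(2πi(q−t))` if `q ∈ ℤ` and `q − t ∉ ℤ`. -/
def Jfac (q : ℚ) (t : ℝ) : ℂ :=
  if ¬ ∃ m : ℤ, (m : ℚ) = q then 0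
  else if (q : ℝ) = t then 1
  else if ∃ m : ℤ, m ≠ 0 ∧ (m : ℝ) = (q : ℝ) - t then 0
  else (e ((q : ℝ) - t) - 1) / (2 * (Real.pi : ℂ) * Complex.I * (((q : ℝ) - t : ℝ) : ℂ))

/-- The factor `J_r`: `0` if `r ∉ ℤ`; `1` if `r ∈ ℤ` and `r = −s`; `0` if `r ∈ ℤ` and
`r + s ∈ ℤ∖{0}`; `(e(r+s) − 1)/(2πi(r+s))` if `r ∈ ℤ` and `r + s ∉ ℤ`. -/
def Ifac (r : ℚ) (s : ℝ) : ℂ :=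
  if ¬ ∃ m : ℤ, (m : ℚ) = r then 0
  else if (r : ℝ) = -s then 1
  else if ∃ m : ℤ, m ≠ 0 ∧ (m : ℝ) = (r : ℝ) + s then 0
  else (e ((r : ℝ) + s) - 1) / (2 * (Real.pi : ℂ) * Complex.I * (((r : ℝ) + s : ℝ) : ℂ))

lemma norm_mul_sub_mul_le {a b c d : ℂ} {δ η : ℝ} (h1 : ‖a - c‖ ≤ δ) (h2 : ‖b - d‖ ≤ η)
    (h3 : ‖b‖ ≤ 1) (h4 : ‖c‖ ≤ 1) : ‖a * b - c * d‖ ≤ δ + η := by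
  have hδ : 0 ≤ δ := (norm_nonneg _).trans h1
  calc ‖a * b - c * d‖ = ‖(a - c) * b + c * (b - d)‖ := by congr 1; ring
    _ ≤ ‖a - c‖ * ‖b‖ + ‖c‖ * ‖b - d‖ := by
      simpa only [norm_mul] using norm_add_le ((a - c) * b) (c * (b - d))
    _ ≤ δ * 1 + 1 * η := by gcongr
    _ = δ + η := by ring

/-- The average of the first `N` values `z 1, …, z N` of a complex sequence. -/
def cesaroMean (z : ℕ → ℂ) (N : ℕ) : ℂ := (N : ℂ)⁻¹ * ∑ n ∈ Finset.Icc 1 N, z n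

lemma cesaroMean_add (z w : ℕ → ℂ) (N : ℕ) :
    cesaroMean (fun n => z n + w n) N = cesaroMean z N + cesaroMean w N := by
  simp [cesaroMean, Finset.sum_add_distrib, mul_add]

lemma cesaroMean_sub (z w : ℕ → ℂ) (N : ℕ) :
    cesaroMean (fun n => z n - w n) N = cesaroMean z N - cesaroMean w N := by
  simp [cesaroMean, Finset.sum_sub_distrib, mul_sub]

lemma cesaroMean_const_mul (c : ℂ) (z : ℕ → ℂ) (N : ℕ) :
    cesaroMean (fun n => c * z n) N = c * cesaroMean z N := by
  simp only [cesaroMean, ← Finset.mul_sum]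
  ring

lemma tendsto_cesaroMean_const (c : ℂ) : Tendsto (cesaroMean fun _ => c) atTop (nhds c) := by
  refine tendsto_const_nhds.congr' ?_
  filter_upwards [eventually_ge_atTop 1] with N hN
  have : (N : ℂ) ≠ 0 := by exact_mod_cast (by omega : N ≠ 0)
  simp [cesaroMean, this]

lemma norm_cesaroMean_le {z : ℕ → ℂ} {b : ℕ → ℝ} (h : ∀ n, ‖z n‖ ≤ b n) (N : ℕ) :
    ‖cesaroMean z N‖ ≤ ‖cesaroMean (fun n => (b n : ℂ)) N‖ := by
  have hb : 0 ≤ ∑ n ∈ Finset.Icc 1 N, b n :=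
    Finset.sum_nonneg fun n _ => (norm_nonneg _).trans (h n)
  simp only [cesaroMean, norm_mul, ← Complex.ofReal_sum, Complex.norm_real, Real.norm_of_nonneg hb]
  gcongr
  exact (norm_sum_le _ _).trans (Finset.sum_le_sum fun n _ => h n)

/-- A sequence that can be approximated in mean by sequences with averages converging to values
close to `L` has averages converging to `L`. -/
lemma tendsto_cesaroMean_of_approx {z : ℕ → ℂ} {L : ℂ}
    (h : ∀ ε > 0, ∃ (z' : ℕ → ℂ) (L' : ℂ) (b : ℕ → ℝ) (B : ℝ),
      Tendsto (cesaroMean z') atTop (nhds L') ∧ ‖L' - L‖ ≤ ε ∧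
      Tendsto (cesaroMean fun n => (b n : ℂ)) atTop (nhds (B : ℂ)) ∧ |B| ≤ ε ∧
      ∀ n, ‖z n - z' n‖ ≤ b n) :
    Tendsto (cesaroMean z) atTop (nhds L) := by
  rw [Metric.tendsto_nhds]
  intro ε hε
  obtain ⟨z', L', b, B, hz', hL, hb, hB, hle⟩ := h (ε / 4) (by positivity)
  have h1 := Metric.tendsto_nhds.1 hz' (ε / 4) (by positivity)
  have h2 : ∀ᶠ N in atTop, ‖cesaroMean (fun n => (b n : ℂ)) N‖ < ε / 2 := by
    refine hb.norm.eventually_lt_const ?_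
    rw [Complex.norm_real, Real.norm_eq_abs]
    linarith
  filter_upwards [h1, h2] with N h1 h2
  have h3 := (norm_cesaroMean_le hle N).trans_lt h2
  rw [cesaroMean_sub] at h3
  rw [dist_eq_norm] at h1 ⊢
  calc ‖cesaroMean z N - L‖
      = ‖(cesaroMean z N - cesaroMean z' N) + (cesaroMean z' N - L') + (L' - L)‖ := by
        congr 1; ring
    _ ≤ _ := norm_add₃_le
    _ < ε := by linarith

lemma e_add (x y : ℝ) : e (x + y) = e x * e y := by
  simp only [e, ← Complex.exp_add]
  push_cast
  ring_nf

lemma e_intCast (m : ℤ) : e m = 1 := by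
  rw [e, Complex.exp_eq_one_iff]
  exact ⟨m, by push_cast; ring⟩

lemma e_eq_one_iff (x : ℝ) : e x = 1 ↔ ∃ m : ℤ, (m : ℝ) = x := by
  refine ⟨fun h => ?_, fun ⟨m, hm⟩ => hm ▸ e_intCast m⟩
  rw [e, Complex.exp_eq_one_iff] at h
  obtain ⟨m, hm⟩ := h
  refine ⟨m, ?_⟩
  have : (x : ℂ) = m := mul_left_cancel₀ Complex.two_pi_I_ne_zero
    (by rw [← mul_comm (m : ℂ), ← hm])
  exact_mod_cast this.symm

@[simp]
lemma norm_e (x : ℝ) : ‖e x‖ = 1 := by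
  rw [e, show 2 * (Real.pi : ℂ) * Complex.I * x = ((2 * Real.pi * x : ℝ) : ℂ) * Complex.I by
    push_cast; ring, Complex.norm_exp_ofReal_mul_I]

@[fun_prop]
lemma continuous_e : Continuous e := by
  unfold e
  fun_prop

lemma e_zero : e 0 = 1 := by simp [e]

lemma e_ne_zero (x : ℝ) : e x ≠ 0 := Complex.exp_ne_zero _

lemma fourier_eq_e (m : ℤ) (x : ℝ) : fourier m (x : UnitAddCircle) = e (m * x) := by
  rw [fourier_coe_apply, e]
  push_cast
  ring_nf

lemma integral_e_mul (x : ℝ) :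
    ∫ v in (0 : ℝ)..1, e (x * v) =
      if x = 0 then 1 else (e x - 1) / (2 * (Real.pi : ℂ) * Complex.I * (x : ℂ)) := by
  split_ifs with hx
  · simp [hx, e_zero]
  · have hc : 2 * (Real.pi : ℂ) * Complex.I * (x : ℂ) ≠ 0 :=
      mul_ne_zero Complex.two_pi_I_ne_zero (by exact_mod_cast hx)
    have := integral_exp_mul_complex (a := 0) (b := 1) hc
    simp only [Complex.ofReal_one, Complex.ofReal_zero, mul_zero, mul_one, Complex.exp_zero] at this
    rw [e, ← this]
    refine intervalIntegral.integral_congr fun v _ => ?_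
    simp only [e]
    push_cast
    ring_nf

/-- The Fourier functional `f ↦ ∫₀¹ e(qv) f(v) dv` for integral `q`, and `0` for other `q`. -/
def fourierFunctional (q : ℚ) (f : ℝ → ℂ) : ℂ :=
  if ∃ m : ℤ, (m : ℚ) = q then ∫ v in (0 : ℝ)..1, e (q * v) * f v else 0

lemma fourierFunctional_add (q : ℚ) {f g : ℝ → ℂ} (hf : Continuous f) (hg : Continuous g) :
    fourierFunctional q (fun v => f v + g v) = fourierFunctional q f + fourierFunctional q g := by
  unfold fourierFunctional
  split_ifs
  · simp only [mul_add]
    exact intervalIntegral.integral_add (Continuous.intervalIntegrable (by fun_prop) _ _)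
      (Continuous.intervalIntegrable (by fun_prop) _ _)
  · simp

lemma fourierFunctional_const_mul (q : ℚ) (c : ℂ) (f : ℝ → ℂ) :
    fourierFunctional q (fun v => c * f v) = c * fourierFunctional q f := by
  unfold fourierFunctional
  split_ifs
  · rw [← intervalIntegral.integral_const_mul]
    simp only [mul_left_comm]
  · simp

lemma norm_fourierFunctional_le (q : ℚ) {f : ℝ → ℂ} {C : ℝ}
    (h : ∀ v ∈ Set.Icc (0 : ℝ) 1, ‖f v‖ ≤ C) :
    ‖fourierFunctional q f‖ ≤ C := by
  unfold fourierFunctional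
  split_ifs
  · have := intervalIntegral.norm_integral_le_of_norm_le_const (a := 0) (b := 1) (C := C)
      (f := fun v => e (q * v) * f v) fun v hv => by
        rw [Set.uIoc_of_le zero_le_one] at hv
        simpa using h v ⟨hv.1.le, hv.2⟩
    simpa using this
  · simpa using (norm_nonneg _).trans (h 0 (by simp))

lemma fourierFunctional_e (q : ℚ) (m : ℤ) :
    fourierFunctional q (fun v => e (m * v)) = if q + m = 0 then 1 else 0 := by
  unfold fourierFunctional
  split_ifs with h h' h'
  · simp only [← e_add, ← add_mul, integral_e_mul]
    exact if_pos (by exact_mod_cast h')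
  · simp only [← e_add, ← add_mul, integral_e_mul]
    rw [if_neg (by exact_mod_cast h')]
    obtain ⟨k, rfl⟩ := h
    have : (((k : ℚ) : ℝ) + (m : ℝ)) = ((k + m : ℤ) : ℝ) := by push_cast; rfl
    rw [this, e_intCast]
    simp
  · exact absurd ⟨-m, by push_cast; linarith⟩ h
  · rfl

lemma fourierFunctional_e_eq_Jfac (q : ℚ) (t : ℝ) :
    fourierFunctional q (fun v => e (-t * v)) = Jfac q t := by
  unfold fourierFunctional Jfac
  split_ifs with h1 h2 h3
  · simp only [← e_add, ← add_mul, integral_e_mul]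
    rw [if_pos (by linarith)]
  · simp only [← e_add, ← add_mul, integral_e_mul, ← sub_eq_add_neg]
    obtain ⟨m, -, hm⟩ := h3
    rw [if_neg (sub_ne_zero.2 h2), ← hm, e_intCast]
    simp
  · simp only [← e_add, ← add_mul, integral_e_mul, ← sub_eq_add_neg]
    rw [if_neg (sub_ne_zero.2 h2)]
  · rfl

/-- Convergence of weighted averages along characters of the circle extends to all continuous
functions on the circle. -/
lemma tendsto_cesaroMean_continuousMap {w : ℕ → ℂ} {C : ℝ} (hw : ∀ n, ‖w n‖ ≤ C) (x : ℕ → ℝ)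
    (q : ℚ) (D : ℂ)
    (h : ∀ m : ℤ, Tendsto (cesaroMean fun n => w n * e (m * x n)) atTop
      (nhds (D * fourierFunctional q (fun v => e (m * v)))))
    (g : C(UnitAddCircle, ℂ)) :
    Tendsto (cesaroMean fun n => w n * g (x n)) atTop
      (nhds (D * fourierFunctional q (fun v => g v))) := by
  have hcont (f : C(UnitAddCircle, ℂ)) : Continuous fun v : ℝ => f v :=
    f.continuous.comp (AddCircle.continuous_mk' 1)
  have hspan : ∀ f ∈ Submodule.span ℂ (Set.range (fourier (T := 1))),
      Tendsto (cesaroMean fun n => w n * f (x n)) atTop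
        (nhds (D * fourierFunctional q (fun v => f v))) := by
    intro f hf
    induction hf using Submodule.span_induction with
    | mem f hf =>
      obtain ⟨m, rfl⟩ := hf
      simpa only [fourier_eq_e] using h m
    | zero =>
      have := fourierFunctional_const_mul q 0 0
      simp only [zero_mul] at this
      simpa [this] using tendsto_cesaroMean_const 0
    | add f g _ _ hf hg =>
      have := hf.add hg
      simp only [← cesaroMean_add, ← mul_add,
        ← fourierFunctional_add q (hcont f) (hcont g)] at this
      exact this
    | smul c f _ hf =>
      have := hf.const_mul c
      rw [mul_left_comm, ← fourierFunctional_const_mul] at this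
      refine this.congr fun N => ?_
      rw [← cesaroMean_const_mul]
      simp [mul_left_comm]
  have hC : 0 ≤ C := (norm_nonneg _).trans (hw 0)
  refine tendsto_cesaroMean_of_approx fun ε hε => ?_
  have hg : g ∈ (Submodule.span ℂ (Set.range (fourier (T := 1)))).topologicalClosure := by
    rw [span_fourier_closure_eq_top]
    trivial
  obtain ⟨f, hf, hfg⟩ := Metric.mem_closure_iff.1 hg (ε / (C + ‖D‖ + 1)) (by positivity)
  rw [lt_div_iff₀ (by positivity), dist_eq_norm] at hfg
  have hpt (y : UnitAddCircle) : ‖g y - f y‖ ≤ ‖g - f‖ := (g - f).norm_coe_le_norm y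
  refine ⟨_, _, fun _ => C * ‖g - f‖, C * ‖g - f‖, hspan f hf, ?_, tendsto_cesaroMean_const _,
    ?_, fun n => ?_⟩
  · have hsub : fourierFunctional q (fun v => g v) =
        fourierFunctional q (fun v => f v) + fourierFunctional q (fun v => (g - f) v) := by
      rw [← fourierFunctional_add q (hcont _) (hcont _)]
      simp
    have hle : ‖fourierFunctional q (fun v => (g - f) v)‖ ≤ ‖g - f‖ :=
      norm_fourierFunctional_le q fun v _ => hpt v
    rw [hsub, mul_add, sub_add_cancel_left, norm_neg, norm_mul]
    nlinarith [norm_nonneg (g - f), norm_nonneg D]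
  · rw [abs_of_nonneg (by positivity)]
    nlinarith [norm_nonneg (g - f), norm_nonneg D]
  · rw [← mul_sub, norm_mul]
    exact mul_le_mul (hw n) (hpt _) (norm_nonneg _) hC

/-- Weyl's criterion, twisted by rational frequencies, for products of continuous functions. -/
lemma tendsto_cesaroMean_twisted {x y : ℕ → ℝ}
    (hequi : ∀ c : ℕ, 1 ≤ c → ∀ k l : ℤ, (k, l) ≠ (0, 0) →
      Tendsto (cesaroMean fun n => e ((k * x n + l * y n) / c)) atTop (nhds 0))
    (q r : ℚ) (g h : C(UnitAddCircle, ℂ)) :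
    Tendsto (cesaroMean fun n => e (q * x n + r * y n) * g (x n) * h (y n)) atTop
      (nhds (fourierFunctional q (fun v => g v) * fourierFunctional r (fun v => h v))) := by
  have hchar (q r : ℚ) : Tendsto (cesaroMean fun n => e (q * x n + r * y n)) atTop
      (nhds (if q = 0 ∧ r = 0 then 1 else 0)) := by
    split_ifs with hqr
    · simpa [hqr.1, hqr.2, e_zero] using tendsto_cesaroMean_const 1
    · have := hequi (q.den * r.den) (Nat.mul_pos q.pos r.pos) (q.num * r.den) (r.num * q.den)
        (by simpa using hqr)
      refine this.congr fun N => ?_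
      congr! 3 with n
      have h1 : (q.den : ℝ) ≠ 0 := by exact_mod_cast q.den_nz
      have h2 : (r.den : ℝ) ≠ 0 := by exact_mod_cast r.den_nz
      rw [Rat.cast_def q, Rat.cast_def r]
      push_cast
      field_simp
  refine tendsto_cesaroMean_continuousMap (C := ‖g‖) (fun n => ?_) y r _ (fun l => ?_) h
  · simpa using g.norm_coe_le_norm _
  rw [mul_comm]
  have hg := tendsto_cesaroMean_continuousMap (w := fun n => e (q * x n + r * y n) * e (l * y n))
    (C := 1) (by simp) x q (fourierFunctional r (fun v => e (l * v))) (fun m => ?_) g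
  · simpa only [mul_right_comm] using hg
  · have := hchar (q + m) (r + l)
    have hite : (if r + l = 0 then 1 else 0) * (if q + m = 0 then 1 else 0) =
        if q + m = 0 ∧ r + l = 0 then (1 : ℂ) else 0 := by
      split_ifs <;> simp_all
    rw [fourierFunctional_e, fourierFunctional_e, hite]
    refine this.congr fun N => ?_
    congr! 2 with n
    rw [← e_add, ← e_add]
    push_cast
    ring_nf

/-- A continuous function on the circle from a continuous function on `[0, 1]` with equal boundary
values. -/
lemma exists_continuousMap_circle {f : ℝ → ℂ} (hf : Continuous f) (h01 : f 0 = f 1) :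
    ∃ g : C(UnitAddCircle, ℂ), (∀ x : ℝ, g x = f (Int.fract x)) ∧
      ∀ v ∈ Set.Icc (0 : ℝ) 1, g v = f v := by
  have hfract (x : ℝ) : AddCircle.liftIco 1 0 f x = f (Int.fract x) := by
    have : (x : UnitAddCircle) = (Int.fract x : ℝ) := by
      rw [← sub_eq_zero, ← AddCircle.coe_sub, Int.self_sub_fract, AddCircle.coe_eq_zero_iff]
      exact ⟨⌊x⌋, by simp⟩
    rw [this, AddCircle.liftIco_coe_apply]
    simp [Int.fract_nonneg, Int.fract_lt_one]
  refine ⟨⟨AddCircle.liftIco 1 0 f, AddCircle.liftIco_continuous (by simpa using h01)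
    hf.continuousOn⟩, hfract, fun v hv => (hfract v).trans ?_⟩
  rcases hv.2.eq_or_lt with rfl | h
  · simpa using h01
  · rw [Int.fract_eq_self.2 ⟨hv.1, h⟩]

lemma integral_bump (m : ℕ) :
    ∫ v in (0 : ℝ)..1, (2 * v - 1) ^ (2 * m) = 1 / (2 * m + 1) := by
  have := intervalIntegral.integral_comp_mul_sub (a := 0) (b := 1)
    (fun v : ℝ => v ^ (2 * m)) (c := 2) two_ne_zero 1
  rw [this, integral_pow]
  have : (2 * (m : ℝ) + 1) ≠ 0 := by positivity
  norm_num [pow_succ, pow_mul]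
  field_simp

lemma bump_nonneg (m : ℕ) (v : ℝ) : 0 ≤ (2 * v - 1) ^ (2 * m) := (even_two_mul m).pow_nonneg _

lemma bump_le_one (m : ℕ) {v : ℝ} (hv : v ∈ Set.Icc (0 : ℝ) 1) : (2 * v - 1) ^ (2 * m) ≤ 1 := by
  rw [pow_mul]
  exact pow_le_one₀ (sq_nonneg _) (by nlinarith [hv.1, hv.2])

/-- The exponential `v ↦ e(tv)` on `[0, 1)` damped near the endpoints. -/
def dampedExp (m : ℕ) (t v : ℝ) : ℂ := e (t * v) * ((1 - (2 * v - 1) ^ (2 * m) : ℝ) : ℂ)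

lemma norm_dampedExp_le (m : ℕ) (t : ℝ) {v : ℝ} (hv : v ∈ Set.Icc (0 : ℝ) 1) :
    ‖dampedExp m t v‖ ≤ 1 := by
  rw [dampedExp, norm_mul, norm_e, Complex.norm_real, one_mul, Real.norm_eq_abs, abs_le]
  constructor <;> linarith [bump_nonneg m v, bump_le_one m hv]

lemma norm_e_sub_dampedExp (m : ℕ) (t v : ℝ) :
    ‖e (t * v) - dampedExp m t v‖ = (2 * v - 1) ^ (2 * m) := by
  have : e (t * v) - dampedExp m t v = e (t * v) * (((2 * v - 1) ^ (2 * m) : ℝ) : ℂ) := by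
    rw [dampedExp]; push_cast; ring
  rw [this, norm_mul, norm_e, one_mul, Complex.norm_real, Real.norm_of_nonneg (bump_nonneg m v)]

@[fun_prop]
lemma continuous_dampedExp (m : ℕ) (t : ℝ) : Continuous (dampedExp m t) := by
  unfold dampedExp
  fun_prop

lemma fourierFunctional_congr (q : ℚ) {f g : ℝ → ℂ} (h : ∀ v ∈ Set.Icc (0 : ℝ) 1, f v = g v) :
    fourierFunctional q f = fourierFunctional q g := by
  unfold fourierFunctional
  split_ifs
  · refine intervalIntegral.integral_congr fun v hv => ?_
    rw [Set.uIcc_of_le zero_le_one] at hv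
    simp only [h v hv]
  · rfl

lemma norm_fourierFunctional_dampedExp_sub (q : ℚ) (m : ℕ) (t : ℝ) :
    ‖fourierFunctional q (dampedExp m t) - fourierFunctional q (fun v => e (t * v))‖ ≤
      1 / (2 * m + 1) := by
  unfold fourierFunctional
  split_ifs
  · rw [← intervalIntegral.integral_sub (Continuous.intervalIntegrable (by fun_prop) _ _)
      (Continuous.intervalIntegrable (by fun_prop) _ _), ← integral_bump]
    refine intervalIntegral.norm_integral_le_of_norm_le zero_le_one (.of_forall fun v _ => ?_)
      (Continuous.intervalIntegrable (by fun_prop) _ _)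
    rw [← mul_sub, norm_mul, norm_e, one_mul, norm_sub_rev, norm_e_sub_dampedExp]
  · simp only [sub_self, norm_zero]
    positivity

/-- The twisted averages of products of exponentials of fractional parts. -/
lemma tendsto_cesaroMean_fract {x y : ℕ → ℝ}
    (hequi : ∀ c : ℕ, 1 ≤ c → ∀ k l : ℤ, (k, l) ≠ (0, 0) →
      Tendsto (cesaroMean fun n => e ((k * x n + l * y n) / c)) atTop (nhds 0))
    (q r : ℚ) (t s : ℝ) :
    Tendsto (cesaroMean fun n => e (q * x n + r * y n) * e (t * Int.fract (x n)) *
        e (s * Int.fract (y n))) atTop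
      (nhds (fourierFunctional q (fun v => e (t * v)) *
        fourierFunctional r (fun v => e (s * v)))) := by
  have hmem (z : ℝ) : Int.fract z ∈ Set.Icc (0 : ℝ) 1 :=
    ⟨Int.fract_nonneg z, (Int.fract_lt_one z).le⟩
  refine tendsto_cesaroMean_of_approx fun ε hε => ?_
  obtain ⟨m, hm⟩ := exists_nat_gt (1 / ε)
  have hmε : 1 / (2 * (m : ℝ) + 1) + 1 / (2 * m + 1) ≤ ε := by
    rw [div_lt_iff₀ hε] at hm
    rw [← add_div, div_le_iff₀ (by positivity)]
    nlinarith
  have hend (t : ℝ) : dampedExp m t 0 = dampedExp m t 1 := by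
    norm_num [dampedExp]
  obtain ⟨g, hg, hg'⟩ := exists_continuousMap_circle (continuous_dampedExp m t) (hend t)
  obtain ⟨h, hh, hh'⟩ := exists_continuousMap_circle (continuous_dampedExp m s) (hend s)
  obtain ⟨p, hp, hp'⟩ := exists_continuousMap_circle
    (f := fun v => (((2 * v - 1) ^ (2 * m) : ℝ) : ℂ)) (by fun_prop) (by norm_num)
  have hbump : fourierFunctional 0 (fun v => p v) = ((1 / (2 * m + 1) : ℝ) : ℂ) := by
    rw [fourierFunctional_congr 0 hp', fourierFunctional, if_pos ⟨0, by simp⟩, ← integral_bump,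
      ← intervalIntegral.integral_ofReal]
    simp [e_zero]
  have hone : fourierFunctional 0 (fun _ => 1) = 1 := by
    rw [fourierFunctional, if_pos ⟨0, by simp⟩]
    simp [e_zero]
  have hpx := tendsto_cesaroMean_twisted hequi 0 0 p 1
  have hpy := tendsto_cesaroMean_twisted hequi 0 0 1 p
  rw [hbump] at hpx hpy
  simp only [ContinuousMap.one_apply, hone, hp, Rat.cast_zero, zero_mul, add_zero, e_zero,
    one_mul, mul_one] at hpx hpy
  have hpxy := hpx.add hpy
  simp only [← cesaroMean_add, ← Complex.ofReal_add] at hpxy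
  have hmain := tendsto_cesaroMean_twisted hequi q r g h
  rw [fourierFunctional_congr q hg', fourierFunctional_congr r hh'] at hmain
  refine ⟨_, _, _, _, hmain, ?_, hpxy, ?_, fun n => ?_⟩
  · refine le_trans ?_ hmε
    have h1 := norm_fourierFunctional_dampedExp_sub q m t
    have h2 := norm_fourierFunctional_dampedExp_sub r m s
    have h3 : ‖fourierFunctional r (dampedExp m s)‖ ≤ 1 :=
      norm_fourierFunctional_le r fun v hv => norm_dampedExp_le m s hv
    have h4 : ‖fourierFunctional q (fun v => e (t * v))‖ ≤ 1 :=
      norm_fourierFunctional_le q fun v _ => (norm_e _).le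
    exact norm_mul_sub_mul_le h1 h2 h3 h4
  · rwa [abs_of_nonneg (by positivity)]
  · rw [hg, hh, mul_assoc, mul_assoc, ← mul_sub, norm_mul, norm_e, one_mul, norm_sub_rev]
    refine norm_mul_sub_mul_le ?_ ?_ (norm_dampedExp_le m s (hmem _)) (norm_e _).le
    · rw [norm_sub_rev, norm_e_sub_dampedExp]
    · rw [norm_sub_rev, norm_e_sub_dampedExp]

lemma Ifac_eq_Jfac (r : ℚ) (s : ℝ) : Ifac r s = Jfac r (-s) := by
  simp only [Ifac, Jfac, sub_neg_eq_add]

lemma Jfac_eq_zero_iff (q : ℚ) (t : ℝ) :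
    Jfac q t = 0 ↔ (¬ ∃ m : ℤ, (m : ℚ) = q) ∨ ∃ m : ℤ, m ≠ 0 ∧ (m : ℝ) = (q : ℝ) - t := by
  unfold Jfac
  split_ifs with h1 h2 h3
  · simp only [one_ne_zero, h1, not_true_eq_false, false_or, false_iff]
    rintro ⟨m, hm, hm'⟩
    rw [h2, sub_self] at hm'
    exact hm (by exact_mod_cast hm')
  · simp [h3]
  · have hne : (q : ℝ) - t ≠ 0 := sub_ne_zero.2 h2
    have hden : 2 * (Real.pi : ℂ) * Complex.I * (((q : ℝ) - t : ℝ) : ℂ) ≠ 0 :=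
      mul_ne_zero Complex.two_pi_I_ne_zero (by exact_mod_cast hne)
    simp only [h1, h3, not_true_eq_false, or_false, iff_false, div_eq_zero_iff, hden,
      sub_eq_zero, e_eq_one_iff]
    rintro ⟨m, hm⟩
    refine h3 ⟨m, ?_, hm⟩
    rintro rfl
    exact hne (by simpa using hm.symm)
  · simp [h1]

/-- Suppose that for every integer `c ≥ 1` the pair
`({a(n)/c}, {(βa(n)+u)/c})` is equidistributed in `[0,1)²`. Then
`(1/N)·Σ e(q·a(n) + rβ·a(n) − {a(n)}t + {βa(n)+u}s)` converges to `e(−ru)·J_q·J_r`, and the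
limit is `0` iff `q ∉ ℤ`, or `q − t ∈ ℤ∖{0}`, or `r ∉ ℤ`, or `r + s ∈ ℤ∖{0}`. -/
theorem stmt7 (β u t s : ℝ) (q r : ℚ) (a : ℕ → ℝ)
    (hequi : ∀ c : ℕ, 1 ≤ c → ∀ k l : ℤ, (k, l) ≠ (0, 0) →
      Tendsto (fun N : ℕ => (N : ℂ)⁻¹ * ∑ n ∈ Finset.Icc 1 N,
          e (((k : ℝ) * a n + (l : ℝ) * (β * a n + u)) / (c : ℝ))) atTop (nhds 0)) :
    Tendsto (fun N : ℕ => (N : ℂ)⁻¹ * ∑ n ∈ Finset.Icc 1 N,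
        e ((q : ℝ) * a n + (r : ℝ) * β * a n - Int.fract (a n) * t +
          Int.fract (β * a n + u) * s)) atTop
      (nhds (e (-((r : ℝ) * u)) * (Jfac q t * Ifac r s))) ∧
    (e (-((r : ℝ) * u)) * (Jfac q t * Ifac r s) = 0 ↔
      (¬ ∃ m : ℤ, (m : ℚ) = q) ∨ (∃ m : ℤ, m ≠ 0 ∧ (m : ℝ) = (q : ℝ) - t) ∨
        (¬ ∃ m : ℤ, (m : ℚ) = r) ∨ ∃ m : ℤ, m ≠ 0 ∧ (m : ℝ) = (r : ℝ) + s) := by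
  constructor
  · have h := (tendsto_cesaroMean_fract (x := a) (y := fun n => β * a n + u)
      hequi q r (-t) s).const_mul
      (e (-(r * u)))
    have hs : fourierFunctional r (fun v => e (s * v)) = Ifac r s := by
      simpa only [neg_neg, Ifac_eq_Jfac] using fourierFunctional_e_eq_Jfac r (-s)
    rw [fourierFunctional_e_eq_Jfac, hs] at h
    refine h.congr fun N => ?_
    rw [← cesaroMean_const_mul, cesaroMean]
    congr! 2 with n
    simp only [← e_add]
    ring_nf
  · rw [Ifac_eq_Jfac, mul_eq_zero, mul_eq_zero, Jfac_eq_zero_iff, Jfac_eq_zero_iff]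
    simp only [e_ne_zero, false_or, sub_neg_eq_add, or_assoc]

end
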